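/- Let E_s > 0, P > 0 and C be real numbers, and set Δ = C²/(E_s·P); assume 0 ≤ Δ < 1. Define, for θ < 0 and a ∈ ℝ, F(θ, a) = (1/2)·ln(1 − 2θa²E_s) + θ(P − 2aC + a²E_s) − θP/(1 − 2θa²E_s). Then the supremum of F(θ, a) over all θ < 0 and a ∈ ℝ equals −(1/2)·ln(1 − Δ) = (1/2)·ln(1 + Δ/(1 − Δ)); moreover, when C ≠ 0 the supremum over θ < 0 for fixed a is maximized over a at a = C/E_s. -/

import Mathlib

open Real

/-- Upper bound for the GMI objective, obtained by completing the square and `log x ≤ x - 1`. -/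
theorem gmi_objective_le {Es P C Δ θ a : ℝ} (hEs : 0 < Es) (hP : 0 < P)
    (hC : C ^ 2 = Δ * (Es * P)) (hΔ1 : Δ < 1) (hθ : θ < 0) :
    (1 / 2) * Real.log (1 - 2 * θ * a ^ 2 * Es) + θ * (P - 2 * a * C + a ^ 2 * Es)
      - θ * P / (1 - 2 * θ * a ^ 2 * Es) ≤ -(1 / 2) * Real.log (1 - Δ) := by
  obtain ⟨u, hu⟩ : ∃ u, u = 1 - 2 * θ * a ^ 2 * Es := ⟨_, rfl⟩
  have hu1 : 1 ≤ u := by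
    have : 0 ≤ -θ * (a ^ 2 * Es) := mul_nonneg (by linarith) (by positivity)
    linarith
  have hu0 : 0 < u := by linarith
  have hlog := Real.log_le_sub_one_of_pos (mul_pos hu0 (sub_pos.2 hΔ1))
  rw [Real.log_mul hu0.ne' (sub_pos.2 hΔ1).ne'] at hlog
  rw [← hu]
  have key : θ * (P - 2 * a * C + a ^ 2 * Es) - θ * P / u
      = -(u - 1) / 2 + Δ * u / 2 - (2 * θ * a * Es * P + C * u) ^ 2 / (2 * Es * P * u) := by
    have hΔ : Δ = C ^ 2 / (Es * P) := by rw [hC]; field_simp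
    rw [hΔ]
    field_simp
    rw [hu]
    ring
  have hsq : 0 ≤ (2 * θ * a * Es * P + C * u) ^ 2 / (2 * Es * P * u) := by positivity
  linarith

/-- The bound `gmi_objective_le` is attained at `θ = -1 / (2P(1 - Δ))`, `a = C / Es`. -/
theorem gmi_objective_eq {Es P C Δ : ℝ} (hEs : 0 < Es) (hP : 0 < P)
    (hC : C ^ 2 = Δ * (Es * P)) (hΔ1 : Δ < 1) {θ : ℝ} (hθ : θ = -1 / (2 * P * (1 - Δ))) :
    (1 / 2) * Real.log (1 - 2 * θ * (C / Es) ^ 2 * Es)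
      + θ * (P - 2 * (C / Es) * C + (C / Es) ^ 2 * Es)
      - θ * P / (1 - 2 * θ * (C / Es) ^ 2 * Es) = -(1 / 2) * Real.log (1 - Δ) := by
  have h1 : 1 - Δ ≠ 0 := (sub_pos.2 hΔ1).ne'
  have hsq : (C / Es) ^ 2 * Es = Δ * P := by
    rw [div_pow, hC]; field_simp
  have hmul : 2 * (C / Es) * C = 2 * (Δ * P) := by
    rw [← hsq]; field_simp
  have hu : 1 - 2 * θ * (C / Es) ^ 2 * Es = (1 - Δ)⁻¹ := by
    rw [mul_assoc, hsq, hθ]; field_simp; ring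
  rw [hu, hsq, hmul, Real.log_inv, hθ]
  field_simp
  ring

/-- The real-analytic optimization underlying the GMI of nearest-neighbor decoding:
with `Δ = C²/(E_s·P) ∈ [0,1)` and
`F(θ,a) = (1/2)ln(1 − 2θa²E_s) + θ(P − 2aC + a²E_s) − θP/(1 − 2θa²E_s)`,
the supremum of `F(θ,a)` over `θ < 0`, `a ∈ ℝ` equals
`−(1/2)ln(1 − Δ) = (1/2)ln(1 + Δ/(1 − Δ))`; moreover when `C ≠ 0` the supremum over
`θ < 0` for fixed `a` is maximized over `a` at `a = C/E_s`. -/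
theorem gmi_optimization
    (Es P C : ℝ) (hEs : 0 < Es) (hP : 0 < P)
    (Δ : ℝ) (hΔdef : Δ = C ^ 2 / (Es * P)) (hΔ0 : 0 ≤ Δ) (hΔ1 : Δ < 1)
    (F : ℝ → ℝ → ℝ)
    (hF : ∀ θ a, F θ a =
      (1 / 2) * Real.log (1 - 2 * θ * a ^ 2 * Es)
        + θ * (P - 2 * a * C + a ^ 2 * Es)
        - θ * P / (1 - 2 * θ * a ^ 2 * Es)) :
    IsLUB {z : ℝ | ∃ θ : ℝ, θ < 0 ∧ ∃ a : ℝ, z = F θ a} (-(1 / 2) * Real.log (1 - Δ))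
    ∧ -(1 / 2) * Real.log (1 - Δ) = (1 / 2) * Real.log (1 + Δ / (1 - Δ))
    ∧ (C ≠ 0 → ∀ a : ℝ,
        sSup {z : ℝ | ∃ θ : ℝ, θ < 0 ∧ z = F θ a} ≤
          sSup {z : ℝ | ∃ θ : ℝ, θ < 0 ∧ z = F θ (C / Es)}) := by
  have hC : C ^ 2 = Δ * (Es * P) := by
    rw [hΔdef]; field_simp
  have hle : ∀ θ a, θ < 0 → F θ a ≤ -(1 / 2) * Real.log (1 - Δ) := fun θ a hθ => by
    rw [hF]; exact gmi_objective_le hEs hP hC hΔ1 hθ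
  have h1 : 0 < 1 - Δ := sub_pos.2 hΔ1
  obtain ⟨θ₀, hθ₀, heq⟩ : ∃ θ, θ < 0 ∧ -(1 / 2) * Real.log (1 - Δ) = F θ (C / Es) := by
    refine ⟨-1 / (2 * P * (1 - Δ)), div_neg_of_neg_of_pos (by norm_num) (by positivity), ?_⟩
    rw [hF]
    exact (gmi_objective_eq hEs hP hC hΔ1 rfl).symm
  refine ⟨IsGreatest.isLUB ⟨⟨θ₀, hθ₀, C / Es, heq⟩, ?_⟩, ?_, fun _ a => ?_⟩
  · rintro _ ⟨θ, hθ, a, rfl⟩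
    exact hle θ a hθ
  · have : 1 + Δ / (1 - Δ) = (1 - Δ)⁻¹ := by field_simp; ring
    rw [this, Real.log_inv]
    ring
  · have hmax : IsGreatest {z : ℝ | ∃ θ : ℝ, θ < 0 ∧ z = F θ (C / Es)}
        (-(1 / 2) * Real.log (1 - Δ)) := by
      refine ⟨⟨θ₀, hθ₀, heq⟩, ?_⟩
      rintro _ ⟨θ, hθ, rfl⟩
      exact hle θ _ hθ
    rw [hmax.csSup_eq]
    refine csSup_le ⟨_, θ₀, hθ₀, rfl⟩ ?_
    rintro _ ⟨θ, hθ, rfl⟩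
    exact hle θ a hθ
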